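/- arXiv:0809.1391 — 2 statements merged into one kernel-verified Lean document; each statement's English description precedes it below -/
import Mathlib

section
/- Let g ≥ 2, τ ∈ ℍ_{g−1}, z ∈ ℂ^{g−1}, ε, δ ∈ {0,1}^{g−1} and δ₁ ∈ {0,1}, and suppose ε·δ = Σ_j ε_j δ_j is even. Then lim_{t→+∞} θ_{[(0,ε),(δ₁,δ)]}(T_t) = θ_{[ε,δ]}(τ), and lim_{t→+∞} q_t^{−4}·(θ_{[(0,ε),(δ₁,δ)]}(T_t) − θ_{[ε,δ]}(τ)) = 2·(−1)^{δ₁}·θ_{[ε,δ]}(τ, z). -/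
open scoped BigOperators

noncomputable section

/-- The Siegel upper half-space: symmetric complex matrices with positive
definite imaginary part (indexed by a finite type `ι`). -/
def Siegel (ι : Type) [Fintype ι] : Set (Matrix ι ι ℂ) :=
  {τ | τ.IsSymm ∧ ∀ v : ι → ℝ, v ≠ 0 → 0 < ∑ i, ∑ j, v i * (τ i j).im * v j}

/-- The theta function with characteristic `[ε, δ]`. -/
def theta {ι : Type} [Fintype ι] (ε δ : ι → ZMod 2) (τ : Matrix ι ι ℂ) (z : ι → ℂ) : ℂ :=
  ∑' n : ι → ℤ, Complex.exp ((Real.pi : ℂ) * Complex.I *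
    ((∑ i, ∑ j, ((n i : ℂ) + ((ε i).val : ℂ) / 2) * τ i j * ((n j : ℂ) + ((ε j).val : ℂ) / 2)) +
     2 * ∑ i, ((n i : ℂ) + ((ε i).val : ℂ) / 2) * (z i + ((δ i).val : ℂ) / 2)))

/-- A theta characteristic, an element of `𝔽₂^{2g}`. -/
abbrev Char2 (ι : Type) := (ι → ZMod 2) × (ι → ZMod 2)

/-- Theta function, with the characteristic as a pair. -/
def thetaChar {ι : Type} [Fintype ι] (m : Char2 ι) (τ : Matrix ι ι ℂ) (z : ι → ℂ) : ℂ :=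
  theta m.1 m.2 τ z

/-- Theta constant. -/
def thetaConst {ι : Type} [Fintype ι] (m : Char2 ι) (τ : Matrix ι ι ℂ) : ℂ :=
  thetaChar m τ 0

/-- The degenerating period matrix `T_t = [[it, zᵀ],[z, τ]]`. -/
noncomputable def Tmat {n : ℕ} (t : ℝ) (z : Fin n → ℂ) (τ : Matrix (Fin n) (Fin n) ℂ) :
    Matrix (Fin 1 ⊕ Fin n) (Fin 1 ⊕ Fin n) ℂ :=
  Matrix.fromBlocks (Matrix.of fun _ _ => (t : ℂ) * Complex.I)
    (Matrix.of fun _ j => z j) (Matrix.of fun i _ => z i) τ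

/-- The boundary parameter `q_t = e^{−πt/4}`. -/
noncomputable def qdeg (t : ℝ) : ℝ := Real.exp (-Real.pi * t / 4)

/-- The genus-`g` characteristic `[(ε₁,ε),(δ₁,δ)]`. -/
def extChar {n : ℕ} (ε₁ δ₁ : ZMod 2) (ε δ : Fin n → ZMod 2) : Char2 (Fin 1 ⊕ Fin n) :=
  (Sum.elim (fun _ => ε₁) ε, Sum.elim (fun _ => δ₁) δ)

/-- The summand of the theta series at the lattice point `n`. -/
def thetaTerm {ι : Type} [Fintype ι] (ε δ : ι → ZMod 2) (τ : Matrix ι ι ℂ) (z : ι → ℂ)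
    (n : ι → ℤ) : ℂ :=
  Complex.exp ((Real.pi : ℂ) * Complex.I *
    ((∑ i, ∑ j, ((n i : ℂ) + ((ε i).val : ℂ) / 2) * τ i j * ((n j : ℂ) + ((ε j).val : ℂ) / 2)) +
     2 * ∑ i, ((n i : ℂ) + ((ε i).val : ℂ) / 2) * (z i + ((δ i).val : ℂ) / 2)))

lemma theta_eq_tsum {ι : Type} [Fintype ι] (ε δ : ι → ZMod 2) (τ : Matrix ι ι ℂ) (z : ι → ℂ) :
    theta ε δ τ z = ∑' n, thetaTerm ε δ τ z n := rfl

/-- A product of nonnegative summable functions is summable over the product type. -/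
lemma summable_pi_prod {ι κ : Type*} [Fintype ι] {f : ι → κ → ℝ}
    (hf0 : ∀ i k, 0 ≤ f i k) (hf : ∀ i, Summable (f i)) :
    Summable fun n : ι → κ => ∏ i, f i (n i) := by
  classical
  refine summable_of_sum_le (c := ∏ i, ∑' k, f i k)
    (fun n => Finset.prod_nonneg fun i _ => hf0 i _) fun s => ?_
  have hsub : s ⊆ Fintype.piFinset fun i => s.image fun n => n i := fun n hn => by
    rw [Fintype.mem_piFinset]
    exact fun i => Finset.mem_image_of_mem _ hn
  calc ∑ n ∈ s, ∏ i, f i (n i)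
      ≤ ∑ n ∈ Fintype.piFinset fun i => s.image fun n => n i, ∏ i, f i (n i) :=
        Finset.sum_le_sum_of_subset_of_nonneg hsub
          fun n _ _ => Finset.prod_nonneg fun i _ => hf0 i _
    _ = ∏ i, ∑ k ∈ s.image fun n => n i, f i k := (Finset.prod_univ_sum _ _).symm
    _ ≤ ∏ i, ∑' k, f i k :=
        Finset.prod_le_prod (fun i _ => Finset.sum_nonneg fun k _ => hf0 i k)
          fun i _ => (hf i).sum_le_tsum _ fun k _ => hf0 i k

/-- Shifted Gaussians are summable over the integers. -/
lemma summable_exp_neg_mul_add_sq {c : ℝ} (hc : 0 < c) (e : ℝ) :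
    Summable fun n : ℤ => Real.exp (-Real.pi * (c * ((n : ℝ) + e) ^ 2)) := by
  have h := summable_pow_mul_jacobiTheta₂_term_bound (c * |e|) hc 0
  simp only [pow_zero, one_mul] at h
  refine Summable.of_nonneg_of_le (fun n => (Real.exp_pos _).le) (fun n => ?_) h
  rw [Real.exp_le_exp, neg_mul, neg_mul, neg_le_neg_iff]
  refine mul_le_mul_of_nonneg_left ?_ Real.pi_pos.le
  push_cast
  have h1 : -(|e| * |(n : ℝ)|) ≤ e * n := by
    rw [← abs_mul]; exact neg_abs_le _
  nlinarith [mul_le_mul_of_nonneg_left h1 hc.le, mul_nonneg hc.le (sq_nonneg e)]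

/-- The imaginary part of a point of the Siegel half-space dominates a multiple of the
standard quadratic form. -/
lemma Siegel.exists_mul_sum_sq_le {ι : Type} [Fintype ι] {τ : Matrix ι ι ℂ}
    (hτ : τ ∈ Siegel ι) :
    ∃ c : ℝ, 0 < c ∧ ∀ v : ι → ℝ, c * ∑ i, v i ^ 2 ≤ ∑ i, ∑ j, v i * (τ i j).im * v j := by
  have hcont : Continuous fun v : ι → ℝ => ∑ i, ∑ j, v i * (τ i j).im * v j := by fun_prop
  have hcomp : IsCompact {v : ι → ℝ | ∑ i, v i ^ 2 = 1} := by
    refine Metric.isCompact_of_isClosed_isBounded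
      (isClosed_eq (by fun_prop) continuous_const) ?_
    refine (Metric.isBounded_closedBall (x := (0 : ι → ℝ)) (r := 1)).subset fun v hv => ?_
    rw [mem_closedBall_zero_iff, pi_norm_le_iff_of_nonneg zero_le_one]
    intro i
    rw [Real.norm_eq_abs, ← sq_le_one_iff_abs_le_one, ← (show ∑ i, v i ^ 2 = 1 from hv)]
    exact Finset.single_le_sum (f := fun i => v i ^ 2) (fun j _ => sq_nonneg _)
      (Finset.mem_univ i)
  obtain ⟨c, hc, hle⟩ := hcomp.exists_forall_le' hcont.continuousOn (a := 0) fun v hv =>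
    hτ.2 v fun h0 => by simp [h0] at hv
  refine ⟨c, hc, fun v => ?_⟩
  rcases (Finset.sum_nonneg fun i (_ : i ∈ Finset.univ) => sq_nonneg (v i)).eq_or_lt with h | h
  · have hv : v = 0 := by
      ext i
      have := (Finset.sum_eq_zero_iff_of_nonneg fun i _ => sq_nonneg (v i)).1 h.symm i
        (Finset.mem_univ i)
      simpa using this
    simp [hv]
  · set s := ∑ i, v i ^ 2 with hs
    have hsq : (Real.sqrt s)⁻¹ ^ 2 = s⁻¹ := by rw [inv_pow, Real.sq_sqrt h.le]
    have key := hle (fun i => (Real.sqrt s)⁻¹ * v i) (by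
      simp only [Set.mem_ofPred_eq, mul_pow, hsq, ← Finset.mul_sum]
      exact inv_mul_cancel₀ h.ne')
    have hre : ∑ i, ∑ j, (Real.sqrt s)⁻¹ * v i * (τ i j).im * ((Real.sqrt s)⁻¹ * v j)
        = s⁻¹ * ∑ i, ∑ j, v i * (τ i j).im * v j := by
      simp_rw [← hsq, Finset.mul_sum]
      exact Finset.sum_congr rfl fun i _ => Finset.sum_congr rfl fun j _ => by ring
    rw [hre, inv_mul_eq_div, le_div_iff₀ h] at key
    exact key

lemma norm_thetaTerm {ι : Type} [Fintype ι] (ε δ : ι → ZMod 2) (τ : Matrix ι ι ℂ) (z : ι → ℂ)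
    (n : ι → ℤ) :
    ‖thetaTerm ε δ τ z n‖ = Real.exp (-Real.pi *
      (∑ i, ∑ j, ((n i : ℝ) + (ε i).val / 2) * (τ i j).im * ((n j : ℝ) + (ε j).val / 2) +
        2 * ∑ i, ((n i : ℝ) + (ε i).val / 2) * (z i).im)) := by
  have hm : ∀ i, (n i : ℂ) + ((ε i).val : ℂ) / 2 = (((n i : ℝ) + (ε i).val / 2 : ℝ) : ℂ) :=
    fun i => by push_cast; rfl
  have hd : ∀ i, (z i + ((δ i).val : ℂ) / 2).im = (z i).im := fun i => by
    rw [show ((δ i).val : ℂ) / 2 = (((δ i).val / 2 : ℝ) : ℂ) by push_cast; rfl]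
    simp
  rw [thetaTerm, Complex.norm_exp, mul_assoc, Complex.re_ofReal_mul, Complex.I_mul_re,
    Complex.add_im, Complex.im_sum, show (2 : ℂ) = ((2 : ℝ) : ℂ) by norm_num,
    Complex.im_ofReal_mul, Complex.im_sum]
  simp only [Complex.ofReal_ofNat, hm, Complex.im_sum, Complex.im_ofReal_mul,
    Complex.im_mul_ofReal, hd]
  rw [mul_neg, neg_mul]

/-- A bound for the theta summands at multiples of `z` that separates the multiple from
the lattice point. -/
lemma exists_norm_thetaTerm_le {ι : Type} [Fintype ι] (ε δ : ι → ZMod 2) {τ : Matrix ι ι ℂ}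
    (hτ : τ ∈ Siegel ι) (z : ι → ℂ) :
    ∃ (C : ℝ) (G : (ι → ℤ) → ℝ), Summable G ∧ ∀ (k : ℤ) (n : ι → ℤ),
      ‖thetaTerm ε δ τ ((k : ℂ) • z) n‖ ≤ Real.exp (Real.pi * (C * k ^ 2)) * G n := by
  obtain ⟨c, hc, hle⟩ := Siegel.exists_mul_sum_sq_le hτ
  refine ⟨∑ i, 2 * (z i).im ^ 2 / c, fun n => ∏ i, Real.exp (-Real.pi *
    (c / 2 * ((n i : ℝ) + (ε i).val / 2) ^ 2)), ?_, fun k n => ?_⟩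
  · exact summable_pi_prod (f := fun i (m : ℤ) => Real.exp (-Real.pi *
      (c / 2 * ((m : ℝ) + (ε i).val / 2) ^ 2))) (fun i m => (Real.exp_pos _).le)
      fun i => summable_exp_neg_mul_add_sq (half_pos hc) _
  · beta_reduce
    rw [norm_thetaTerm, ← Real.exp_sum, ← Real.exp_add, Real.exp_le_exp, ← Finset.mul_sum,
      neg_mul, neg_mul, ← sub_eq_add_neg, ← mul_sub, ← mul_neg]
    refine mul_le_mul_of_nonneg_left ?_ Real.pi_pos.le
    have h1 := hle fun i => (n i : ℝ) + (ε i).val / 2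
    have h2 : ∑ i, c / 2 * ((n i : ℝ) + (ε i).val / 2) ^ 2
        - (∑ i, 2 * (z i).im ^ 2 / c) * (k : ℝ) ^ 2
        ≤ c * ∑ i, ((n i : ℝ) + (ε i).val / 2) ^ 2 +
          2 * ∑ i, ((n i : ℝ) + (ε i).val / 2) * (((k : ℂ) • z) i).im := by
      rw [Finset.sum_mul, ← Finset.sum_sub_distrib, Finset.mul_sum, Finset.mul_sum,
        ← Finset.sum_add_distrib]
      refine Finset.sum_le_sum fun i _ => ?_
      have h3 : (((k : ℂ) • z) i).im = k * (z i).im := by simp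
      rw [h3]
      generalize (n i : ℝ) + (ε i).val / 2 = m
      have h4 : 0 ≤ 2 / c * (c / 2 * m + k * (z i).im) ^ 2 := by positivity
      have h5 : 2 / c * (c / 2 * m + k * (z i).im) ^ 2 = c / 2 * m ^ 2
          + 2 * (m * (k * (z i).im)) + 2 * (z i).im ^ 2 / c * k ^ 2 := by
        field_simp
        ring
      linarith
    linarith

/-- The theta summand of the degenerating matrix factors through the theta summand
of the lower-right block. -/
lemma thetaTerm_Tmat {m : ℕ} (t : ℝ) (z : Fin m → ℂ) (τ : Matrix (Fin m) (Fin m) ℂ)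
    (ε δ : Fin m → ZMod 2) (δ₁ : ZMod 2) (k : Fin 1 → ℤ) (n : Fin m → ℤ) :
    thetaTerm (extChar 0 δ₁ ε δ).1 (extChar 0 δ₁ ε δ).2 (Tmat t z τ) 0 (Sum.elim k n) =
      (Real.exp (-Real.pi * t * (k 0 : ℝ) ^ 2) : ℂ) * (-1) ^ (k 0 * (δ₁.val : ℤ)) *
        thetaTerm ε δ τ ((k 0 : ℂ) • z) n := by
  have hsign : (-1 : ℂ) ^ (k 0 * (δ₁.val : ℤ)) =
      Complex.exp (((k 0 * (δ₁.val : ℤ) : ℤ) : ℂ) * (Real.pi * Complex.I)) := by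
    rw [Complex.exp_int_mul, Complex.exp_pi_mul_I]
  rw [hsign, thetaTerm, thetaTerm, Complex.ofReal_exp, ← Complex.exp_add, ← Complex.exp_add]
  congr 1
  simp only [extChar, Tmat, Fintype.sum_sum_type, Fin.sum_univ_one, Fin.isValue, Sum.elim_inl,
    Sum.elim_inr, Matrix.fromBlocks_apply₁₁, Matrix.fromBlocks_apply₁₂,
    Matrix.fromBlocks_apply₂₁, Matrix.fromBlocks_apply₂₂, Matrix.of_apply, ZMod.val_zero,
    Nat.cast_zero, zero_div, add_zero, zero_add, Pi.zero_apply, Pi.smul_apply, smul_eq_mul,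
    Finset.sum_add_distrib]
  have h1 : ∑ x, (k 0 : ℂ) * z x * ((n x : ℂ) + ((ε x).val : ℂ) / 2) =
      ∑ x, ((n x : ℂ) + ((ε x).val : ℂ) / 2) * ((k 0 : ℂ) * z x) :=
    Finset.sum_congr rfl fun x _ => by ring
  have h2 : ∑ x, ((n x : ℂ) + ((ε x).val : ℂ) / 2) * z x * (k 0 : ℂ) =
      ∑ x, ((n x : ℂ) + ((ε x).val : ℂ) / 2) * ((k 0 : ℂ) * z x) :=
    Finset.sum_congr rfl fun x _ => by ring
  have h3 : ∑ x, ((n x : ℂ) + ((ε x).val : ℂ) / 2) * ((k 0 : ℂ) * z x + ((δ x).val : ℂ) / 2) =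
      ∑ x, ((n x : ℂ) + ((ε x).val : ℂ) / 2) * ((k 0 : ℂ) * z x) +
        ∑ x, ((n x : ℂ) + ((ε x).val : ℂ) / 2) * (((δ x).val : ℂ) / 2) := by
    simp only [mul_add, Finset.sum_add_distrib]
  rw [h1, h2, h3]
  push_cast
  linear_combination (Real.pi * t * (k 0 : ℂ) ^ 2) * Complex.I_sq

/-- The theta function with an even characteristic is an even function. -/
lemma theta_neg {ι : Type} [Fintype ι] (ε δ : ι → ZMod 2) (τ : Matrix ι ι ℂ) (z : ι → ℂ)
    (heven : Even (∑ j, (ε j).val * (δ j).val)) : theta ε δ τ (-z) = theta ε δ τ z := by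
  rw [theta_eq_tsum, theta_eq_tsum,
    ← (Equiv.subLeft (fun i => -((ε i).val : ℤ))).tsum_eq (thetaTerm ε δ τ (-z))]
  refine tsum_congr fun n => ?_
  have hm : ∀ i, (((Equiv.subLeft (fun i => -((ε i).val : ℤ))) n i : ℤ) : ℂ)
      + ((ε i).val : ℂ) / 2 = -((n i : ℂ) + ((ε i).val : ℂ) / 2) := fun i => by
    simp only [Equiv.subLeft_apply, Pi.sub_apply]
    push_cast
    ring
  obtain ⟨r, hr⟩ := heven
  rw [thetaTerm, thetaTerm, Complex.exp_eq_exp_iff_exists_int]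
  refine ⟨-(∑ i, n i * (δ i).val) - r, ?_⟩
  have hr' : ∑ j, ((ε j).val : ℂ) * ((δ j).val : ℂ) = r + r := by exact_mod_cast hr
  have hlin : ∑ i, -((n i : ℂ) + ((ε i).val : ℂ) / 2) * ((-z) i + ((δ i).val : ℂ) / 2) =
      ∑ i, ((n i : ℂ) + ((ε i).val : ℂ) / 2) * (z i + ((δ i).val : ℂ) / 2)
        - ∑ i, (n i : ℂ) * ((δ i).val : ℂ) - r := by
    have : (r : ℂ) = ∑ i, ((ε i).val : ℂ) * ((δ i).val : ℂ) / 2 := by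
      rw [← Finset.sum_div, hr']; ring
    rw [this, ← Finset.sum_sub_distrib, ← Finset.sum_sub_distrib]
    exact Finset.sum_congr rfl fun i _ => by rw [Pi.neg_apply]; ring
  simp only [hm, hlin]
  simp only [neg_mul, mul_neg, neg_neg]
  push_cast
  ring

/-- The Fourier–Jacobi expansion of a theta constant with top characteristic `[0, δ₁]`. -/
lemma exists_thetaConst_Tmat_eq_tsum {m : ℕ} {τ : Matrix (Fin m) (Fin m) ℂ}
    (hτ : τ ∈ Siegel (Fin m)) (z : Fin m → ℂ) (ε δ : Fin m → ZMod 2) (δ₁ : ZMod 2) :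
    ∃ C K : ℝ, (∀ k : ℤ, ‖theta ε δ τ ((k : ℂ) • z)‖ ≤ K * Real.exp (Real.pi * (C * k ^ 2))) ∧
      ∀ t, C + 1 ≤ t → thetaConst (extChar 0 δ₁ ε δ) (Tmat t z τ) =
        ∑' k : ℤ, (Real.exp (-Real.pi * t * (k : ℝ) ^ 2) : ℂ) * (-1) ^ (k * (δ₁.val : ℤ)) *
          theta ε δ τ ((k : ℂ) • z) := by
  obtain ⟨C, G, hG, hle⟩ := exists_norm_thetaTerm_le ε δ hτ z
  refine ⟨C, ∑' n, G n, fun k => ?_, fun t ht => ?_⟩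
  · rw [theta_eq_tsum, mul_comm, ← tsum_mul_left]
    exact tsum_of_norm_bounded (hG.mul_left _).hasSum (hle k)
  · have hk : Summable fun k : ℤ => Real.exp (-Real.pi * (1 * ((k : ℝ) + 0) ^ 2)) :=
      summable_exp_neg_mul_add_sq one_pos 0
    let e : ℤ × (Fin m → ℤ) ≃ (Fin 1 ⊕ Fin m → ℤ) :=
      ((Equiv.funUnique (Fin 1) ℤ).symm.prodCongr (Equiv.refl _)).trans
        (Equiv.sumArrowEquivProdArrow (Fin 1) (Fin m) ℤ).symm
    have he : ∀ p : ℤ × (Fin m → ℤ), e p = Sum.elim (fun _ => p.1) p.2 := fun p => by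
      ext (i | i) <;> rfl
    have hsum : Summable fun p : ℤ × (Fin m → ℤ) =>
        (Real.exp (-Real.pi * t * (p.1 : ℝ) ^ 2) : ℂ) * (-1) ^ (p.1 * (δ₁.val : ℤ)) *
          thetaTerm ε δ τ ((p.1 : ℂ) • z) p.2 := by
      have hG0 : ∀ n, 0 ≤ G n := fun n => by
        have := (norm_nonneg _).trans (hle 0 n)
        exact nonneg_of_mul_nonneg_right this (Real.exp_pos _)
      refine (hk.mul_of_nonneg hG (fun k => (Real.exp_pos _).le) hG0).of_norm_bounded
        fun p => ?_
      rw [norm_mul, norm_mul, norm_zpow, norm_neg, norm_one, one_zpow, mul_one,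
        Complex.norm_real, Real.norm_of_nonneg (Real.exp_pos _).le]
      calc _ ≤ Real.exp (-Real.pi * t * (p.1 : ℝ) ^ 2) *
            (Real.exp (Real.pi * (C * p.1 ^ 2)) * G p.2) :=
            mul_le_mul_of_nonneg_left (hle _ _) (Real.exp_pos _).le
        _ ≤ _ := by
            rw [← mul_assoc, ← Real.exp_add]
            refine mul_le_mul_of_nonneg_right (Real.exp_le_exp.2 ?_) (hG0 _)
            nlinarith [mul_le_mul_of_nonneg_left ht
              (mul_nonneg Real.pi_pos.le (sq_nonneg (p.1 : ℝ)))]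
    rw [thetaConst, thetaChar, theta_eq_tsum, ← e.tsum_eq]
    simp only [he, thetaTerm_Tmat]
    rw [hsum.tsum_prod]
    exact tsum_congr fun k => by simp only [tsum_mul_left, theta_eq_tsum]

open Filter in
/-- Leading behaviour as `t → ∞` of a theta-like series with coefficients of at most
Gaussian growth. -/
lemma tendsto_exp_mul_tsum_sub {a : ℤ → ℂ} {C K : ℝ}
    (ha : ∀ k : ℤ, ‖a k‖ ≤ K * Real.exp (Real.pi * (C * k ^ 2))) :
    Tendsto (fun t : ℝ => (Real.exp (Real.pi * t) : ℂ) *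
      ((∑' k : ℤ, (Real.exp (-Real.pi * t * (k : ℝ) ^ 2) : ℂ) * a k) - a 0)) atTop
      (nhds (a 1 + a (-1))) := by
  have hK : 0 ≤ K := nonneg_of_mul_nonneg_left ((norm_nonneg _).trans (ha 0)) (Real.exp_pos _)
  have hk : Summable fun k : ℤ => Real.exp (-Real.pi * (1 * ((k : ℝ) + 0) ^ 2)) :=
    summable_exp_neg_mul_add_sq one_pos 0
  have hnorm : ∀ (t : ℝ) (k : ℤ), ‖(Real.exp (-Real.pi * t * (k : ℝ) ^ 2) : ℂ) * a k‖ ≤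
      K * Real.exp (-Real.pi * ((t - C) * k ^ 2)) := fun t k => by
    rw [norm_mul, Complex.norm_real, Real.norm_of_nonneg (Real.exp_pos _).le]
    refine (mul_le_mul_of_nonneg_left (ha k) (Real.exp_pos _).le).trans_eq ?_
    rw [mul_left_comm, ← Real.exp_add]
    ring_nf
  have hsum : ∀ t, C + 1 ≤ t →
      Summable fun k : ℤ => (Real.exp (-Real.pi * t * (k : ℝ) ^ 2) : ℂ) * a k := fun t ht => by
    refine (hk.mul_left K).of_norm_bounded fun k => (hnorm t k).trans ?_
    refine mul_le_mul_of_nonneg_left (Real.exp_le_exp.2 ?_) hK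
    nlinarith [mul_le_mul_of_nonneg_left ht
      (mul_nonneg Real.pi_pos.le (sq_nonneg (k : ℝ)))]
  have hlim : (a 1 + a (-1)) = ∑' k : ℤ, if k = 1 ∨ k = -1 then a k else 0 := by
    rw [tsum_eq_sum (s := {1, -1}) fun k hk => by simp_all]
    simp
  rw [hlim]
  have hdom : Tendsto (fun t : ℝ => ∑' k : ℤ, (Real.exp (Real.pi * t) : ℂ) *
      (if k = 0 then 0 else (Real.exp (-Real.pi * t * (k : ℝ) ^ 2) : ℂ) * a k)) atTop
      (nhds (∑' k : ℤ, if k = 1 ∨ k = -1 then a k else 0)) := by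
    refine tendsto_tsum_of_dominated_convergence
      ((hk.mul_left K).mul_left (Real.exp (Real.pi * (C + 1)))) (fun k => ?_) ?_
    · by_cases h0 : k = 0
      · simp [h0]
      · simp only [h0, if_false, ← mul_assoc, ← Complex.ofReal_mul, ← Real.exp_add]
        by_cases h1 : k = 1 ∨ k = -1
        · have : (k : ℝ) ^ 2 = 1 := by rcases h1 with rfl | rfl <;> norm_num
          simp [h1, this]
        · have hk2 : (1 : ℝ) < (k : ℝ) ^ 2 := by
            have : 1 < k ^ 2 := by
              rw [one_lt_sq_iff_one_lt_abs]
              grind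
            exact_mod_cast this
          have hexp : Tendsto (fun t : ℝ => Real.exp (Real.pi * t + -Real.pi * t * (k : ℝ) ^ 2))
              atTop (nhds 0) := by
            refine Real.tendsto_exp_atBot.comp ?_
            have : (fun t : ℝ => Real.pi * t + -Real.pi * t * (k : ℝ) ^ 2) =
                fun t => -(Real.pi * ((k : ℝ) ^ 2 - 1)) * t := by ext t; ring
            rw [this]
            exact tendsto_id.const_mul_atTop_of_neg
              (neg_neg_of_pos (mul_pos Real.pi_pos (sub_pos.2 hk2)))
          have := (Complex.continuous_ofReal.tendsto 0).comp hexp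
          simpa [h1, Function.comp_def] using this.mul_const (a k)
    · filter_upwards [eventually_ge_atTop (C + 1)] with t ht k
      by_cases h0 : k = 0
      · rw [if_pos h0, mul_zero, norm_zero]
        positivity
      · have hk2 : (1 : ℝ) ≤ (k : ℝ) ^ 2 := by
          exact_mod_cast (one_le_sq_iff_one_le_abs k).2 (Int.one_le_abs h0)
        rw [if_neg h0, norm_mul, Complex.norm_real, Real.norm_of_nonneg (Real.exp_pos _).le]
        refine (mul_le_mul_of_nonneg_left (hnorm t k) (Real.exp_pos _).le).trans ?_
        rw [mul_left_comm, mul_left_comm (Real.exp (Real.pi * (C + 1))), ← Real.exp_add,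
          ← Real.exp_add]
        refine mul_le_mul_of_nonneg_left (Real.exp_le_exp.2 ?_) hK
        nlinarith [mul_nonneg Real.pi_pos.le
          (mul_nonneg (sub_nonneg.2 ht) (sub_nonneg.2 hk2))]
  refine hdom.congr' ?_
  filter_upwards [eventually_ge_atTop (C + 1)] with t ht
  rw [tsum_mul_left, (hsum t ht).tsum_eq_add_tsum_ite 0]
  simp

open Filter in
/-- Fourier–Jacobi expansion of theta constants with characteristic `[(0,ε),(δ₁,δ)]`
near the boundary: the constant term is `θ_{[ε,δ]}(τ)`, and the next term is
`2·(−1)^{δ₁}·θ_{[ε,δ]}(τ,z)·q_t⁴`. -/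
theorem theta_const_boundary_expansion_even_top (g : ℕ) (hg : 2 ≤ g)
    (τ : Matrix (Fin (g - 1)) (Fin (g - 1)) ℂ) (hτ : τ ∈ Siegel (Fin (g - 1)))
    (z : Fin (g - 1) → ℂ) (ε δ : Fin (g - 1) → ZMod 2) (δ₁ : ZMod 2)
    (heven : Even (∑ j, (ε j).val * (δ j).val)) :
    Tendsto (fun t : ℝ => thetaConst (extChar 0 δ₁ ε δ) (Tmat t z τ)) atTop
      (nhds (thetaConst (ε, δ) τ)) ∧
    Tendsto (fun t : ℝ =>
        ((qdeg t : ℂ))⁻¹ ^ 4 *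
          (thetaConst (extChar 0 δ₁ ε δ) (Tmat t z τ) - thetaConst (ε, δ) τ)) atTop
      (nhds (2 * (-1 : ℂ) ^ (δ₁.val) * thetaChar (ε, δ) τ z)) := by
  obtain ⟨C, K, hbound, hexpand⟩ := exists_thetaConst_Tmat_eq_tsum hτ z ε δ δ₁
  have hnear : Tendsto (fun t : ℝ => ((qdeg t : ℂ))⁻¹ ^ 4 *
      (thetaConst (extChar 0 δ₁ ε δ) (Tmat t z τ) - thetaConst (ε, δ) τ)) atTop
      (nhds (2 * (-1 : ℂ) ^ (δ₁.val) * thetaChar (ε, δ) τ z)) := by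
    have hlim := tendsto_exp_mul_tsum_sub
      (a := fun k => (-1 : ℂ) ^ (k * (δ₁.val : ℤ)) * theta ε δ τ ((k : ℂ) • z)) (C := C) (K := K)
      fun k => by
        rw [norm_mul, norm_zpow, norm_neg, norm_one, one_zpow, one_mul]
        exact hbound k
    have hval : (-1 : ℂ) ^ ((1 : ℤ) * (δ₁.val : ℤ)) * theta ε δ τ (((1 : ℤ) : ℂ) • z) +
        (-1 : ℂ) ^ ((-1 : ℤ) * (δ₁.val : ℤ)) * theta ε δ τ (((-1 : ℤ) : ℂ) • z) =
        2 * (-1 : ℂ) ^ (δ₁.val) * thetaChar (ε, δ) τ z := by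
      have hinv : ((-1 : ℂ) ^ δ₁.val)⁻¹ = (-1) ^ δ₁.val := by rw [← inv_pow, inv_neg_one]
      simp only [Int.cast_one, one_smul, Int.cast_neg, neg_smul, theta_neg ε δ τ z heven,
        thetaChar, one_mul, neg_mul, zpow_neg, zpow_natCast, hinv]
      ring
    rw [hval] at hlim
    refine hlim.congr' ?_
    filter_upwards [eventually_ge_atTop (C + 1)] with t ht
    have hq : ((qdeg t : ℂ))⁻¹ ^ 4 = (Real.exp (Real.pi * t) : ℂ) := by
      rw [qdeg, ← Complex.ofReal_inv, ← Real.exp_neg, ← Complex.ofReal_pow, ← Real.exp_nat_mul]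
      congr 2
      push_cast
      ring
    rw [hq, hexpand t ht]
    simp [thetaConst, thetaChar, mul_assoc]
  refine ⟨?_, hnear⟩
  have hq0 : Tendsto (fun t : ℝ => (qdeg t : ℂ) ^ 4) atTop (nhds 0) := by
    have h : Tendsto qdeg atTop (nhds 0) := by
      refine Real.tendsto_exp_atBot.comp ?_
      have : (fun t : ℝ => -Real.pi * t / 4) = fun t => -(Real.pi / 4) * t := by ext t; ring
      rw [this]
      exact tendsto_id.const_mul_atTop_of_neg (neg_neg_of_pos (by positivity))
    simpa using ((Complex.continuous_ofReal.tendsto 0).comp h).pow 4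
  have hprod := (hq0.mul hnear).add_const (thetaConst (ε, δ) τ)
  rw [zero_mul, zero_add] at hprod
  refine hprod.congr fun t => ?_
  have hne : (qdeg t : ℂ) ≠ 0 := Complex.ofReal_ne_zero.2 (Real.exp_pos _).ne'
  rw [← mul_assoc, ← mul_pow, mul_inv_cancel₀ hne, one_pow, one_mul, sub_add_cancel]
end
end

section
/- For every integer g ≥ 2, every τ ∈ ℍ_{g−1} and every z ∈ ℂ^{g−1}: lim_{t→+∞} F_g(T_t) = 4·F_{g−1}(τ). -/
open scoped BigOperators

noncomputable section

/-- The modular form `F_g(τ) = 2^g·Σ_m θ_m(τ)^{16} − (Σ_m θ_m(τ)^8)²`. -/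
noncomputable def Fmod (ι : Type) [Fintype ι] [DecidableEq ι] (τ : Matrix ι ι ℂ) : ℂ :=
  2 ^ (Fintype.card ι) * ∑ m : Char2 ι, thetaConst m τ ^ 16 -
    (∑ m : Char2 ι, thetaConst m τ ^ 8) ^ 2

/-- The product of summable nonnegative families is summable over the functions on a finite type. -/
lemma summable_prod_apply {ι κ : Type*} [Fintype ι] {f : ι → κ → ℝ}
    (hf₀ : ∀ i k, 0 ≤ f i k) (hf : ∀ i, Summable (f i)) :
    Summable fun n : ι → κ => ∏ i, f i (n i) := by
  classical
  refine summable_of_sum_le (c := ∏ i, ∑' k, f i k)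
    (fun n => Finset.prod_nonneg fun i _ => hf₀ i _) fun s => ?_
  calc ∑ n ∈ s, ∏ i, f i (n i)
      ≤ ∑ n ∈ Fintype.piFinset fun i => s.image fun n => n i, ∏ i, f i (n i) := by
        refine Finset.sum_le_sum_of_subset_of_nonneg (fun n hn => ?_)
          fun n _ _ => Finset.prod_nonneg fun i _ => hf₀ i _
        exact Fintype.mem_piFinset.2 fun i => Finset.mem_image_of_mem _ hn
    _ = ∏ i, ∑ k ∈ s.image fun n => n i, f i k := (Finset.prod_univ_sum _ _).symm
    _ ≤ ∏ i, ∑' k, f i k :=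
        Finset.prod_le_prod (fun i _ => Finset.sum_nonneg fun k _ => hf₀ i k)
          fun i _ => (hf i).sum_le_tsum _ fun k _ => hf₀ i k

/-- Gaussian sums over a shifted integer lattice converge. -/
lemma summable_exp_neg_shifted_sq {ι : Type*} [Fintype ι] {c : ℝ} (hc : 0 < c) (s : ι → ℝ) :
    Summable fun n : ι → ℤ => Real.exp (-Real.pi * (c * ∑ i, (n i + s i) ^ 2)) := by
  have h : ∀ i, Summable fun k : ℤ => Real.exp (-Real.pi * (c * (k + s i) ^ 2)) := fun i => by
    refine Summable.of_nonneg_of_le (fun _ => (Real.exp_pos _).le) (fun k => ?_)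
      (summable_pow_mul_jacobiTheta₂_term_bound (c * |s i|) hc 0)
    rw [pow_zero, one_mul, Real.exp_le_exp]
    refine mul_le_mul_of_nonpos_left ?_ (neg_nonpos.2 Real.pi_pos.le)
    have h₁ : -(|s i| * |(k : ℝ)|) ≤ k * s i := by
      rw [← abs_mul, mul_comm]; exact neg_abs_le _
    push_cast
    nlinarith [mul_le_mul_of_nonneg_left h₁ hc.le, mul_nonneg hc.le (sq_nonneg (s i))]
  refine (summable_prod_apply (fun i k => (Real.exp_pos _).le) h).congr fun n => ?_
  rw [← Real.exp_sum, Finset.mul_sum, Finset.mul_sum]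

/-- A positive definite quadratic form dominates a positive multiple of the sum of squares. -/
lemma Siegel.exists_pos_mul_sum_sq_le {ι : Type} [Fintype ι] {τ : Matrix ι ι ℂ}
    (hτ : τ ∈ Siegel ι) :
    ∃ c > 0, ∀ v : ι → ℝ, c * ∑ i, v i ^ 2 ≤ ∑ i, ∑ j, v i * (τ i j).im * v j := by
  obtain ⟨c, hc, h⟩ : ∃ c : ℝ, 0 < c ∧ ∀ v ∈ Metric.sphere (0 : ι → ℝ) 1,
      c ≤ ∑ i, ∑ j, v i * (τ i j).im * v j := by
    refine (isCompact_sphere _ _).exists_forall_le' (by fun_prop) fun v hv => hτ.2 v ?_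
    rintro rfl
    simp at hv
  refine ⟨c / (Fintype.card ι + 1), by positivity, fun v => ?_⟩
  rcases eq_or_ne v 0 with rfl | hv
  · simp
  have hv' : ‖v‖ ≠ 0 := norm_ne_zero_iff.2 hv
  have h₁ := h (‖v‖⁻¹ • v) (by simp [norm_smul, hv'])
  have h₂ : ∑ i, ∑ j, (‖v‖⁻¹ • v) i * (τ i j).im * (‖v‖⁻¹ • v) j =
      (∑ i, ∑ j, v i * (τ i j).im * v j) / ‖v‖ ^ 2 := by
    simp only [Finset.sum_div, Pi.smul_apply, smul_eq_mul]
    refine Finset.sum_congr rfl fun i _ => Finset.sum_congr rfl fun j _ => ?_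
    field_simp
  rw [h₂, le_div_iff₀ (by positivity)] at h₁
  have h₃ : ∑ i, v i ^ 2 ≤ (Fintype.card ι + 1) * ‖v‖ ^ 2 := by
    calc ∑ i, v i ^ 2 ≤ ∑ _i : ι, ‖v‖ ^ 2 :=
          Finset.sum_le_sum fun i _ => sq_le_sq.2 <| by
            simpa using norm_le_pi_norm v i
      _ ≤ _ := by simp; nlinarith [sq_nonneg ‖v‖]
  calc c / (Fintype.card ι + 1) * ∑ i, v i ^ 2
      ≤ c / (Fintype.card ι + 1) * ((Fintype.card ι + 1) * ‖v‖ ^ 2) := by gcongr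
    _ = c * ‖v‖ ^ 2 := by field_simp
    _ ≤ _ := h₁

/-- The general term of the series of a theta constant. -/
def thetaConstTerm {ι : Type} [Fintype ι] (m : Char2 ι) (τ : Matrix ι ι ℂ) (n : ι → ℤ) : ℂ :=
  Complex.exp ((Real.pi : ℂ) * Complex.I *
    ((∑ i, ∑ j, ((n i : ℂ) + ((m.1 i).val : ℂ) / 2) * τ i j *
        ((n j : ℂ) + ((m.1 j).val : ℂ) / 2)) +
      2 * ∑ i, ((n i : ℂ) + ((m.1 i).val : ℂ) / 2) * (((m.2 i).val : ℂ) / 2)))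

lemma thetaConst_eq_tsum {ι : Type} [Fintype ι] (m : Char2 ι) (τ : Matrix ι ι ℂ) :
    thetaConst m τ = ∑' n, thetaConstTerm m τ n := by
  simp [thetaConst, thetaChar, theta, thetaConstTerm]

lemma norm_thetaConstTerm {ι : Type} [Fintype ι] (m : Char2 ι) (τ : Matrix ι ι ℂ) (n : ι → ℤ) :
    ‖thetaConstTerm m τ n‖ = Real.exp (-Real.pi * ∑ i, ∑ j,
      ((n i : ℝ) + ((m.1 i).val : ℝ) / 2) * (τ i j).im * ((n j : ℝ) + ((m.1 j).val : ℝ) / 2)) := by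
  have hx : ∀ i, ((n i : ℂ) + ((m.1 i).val : ℂ) / 2) =
      (((n i : ℝ) + ((m.1 i).val : ℝ) / 2 : ℝ) : ℂ) := fun i => by push_cast; rfl
  have hy : ∀ i, (((m.2 i).val : ℂ) / 2) = ((((m.2 i).val : ℝ) / 2 : ℝ) : ℂ) :=
    fun i => by push_cast; rfl
  have h2 : (2 : ℂ) = ((2 : ℝ) : ℂ) := by norm_num
  rw [thetaConstTerm, Complex.norm_exp]
  simp only [hx, hy]
  congr 1
  generalize hS : (∑ i, (((n i : ℝ) + ((m.1 i).val : ℝ) / 2 : ℝ) : ℂ) *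
    ((((m.2 i).val : ℝ) / 2 : ℝ) : ℂ)) = S
  have hS0 : S.im = 0 := by
    rw [← hS, Complex.im_sum]
    exact Finset.sum_eq_zero fun i _ => by rw [← Complex.ofReal_mul, Complex.ofReal_im]
  rw [mul_assoc, Complex.re_ofReal_mul, Complex.I_mul_re, Complex.add_im, h2,
    Complex.im_ofReal_mul, hS0]
  simp only [Complex.im_sum, Complex.im_mul_ofReal, Complex.im_ofReal_mul]
  ring

/-- The lower bound of the imaginary part of `Tmat t z τ` as a quadratic form, uniform in `t`. -/
lemma exists_le_im_Tmat {k : ℕ} {τ : Matrix (Fin k) (Fin k) ℂ} (hτ : τ ∈ Siegel (Fin k))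
    (z : Fin k → ℂ) :
    ∃ c > 0, ∃ K : ℝ, ∀ (t : ℝ) (v : Fin 1 ⊕ Fin k → ℝ),
      (t - K) * v (.inl 0) ^ 2 + c * ∑ j, v (.inr j) ^ 2 ≤
        ∑ i, ∑ j, v i * (Tmat t z τ i j).im * v j := by
  obtain ⟨c, hc, h⟩ := Siegel.exists_pos_mul_sum_sq_le hτ
  refine ⟨c / 2, by positivity, ∑ j, 2 / c * (z j).im ^ 2, fun t v => ?_⟩
  have h₁ := h fun j => v (.inr j)
  have h₂ : -(∑ j, 2 / c * (z j).im ^ 2) * v (.inl 0) ^ 2 - c / 2 * ∑ j, v (.inr j) ^ 2 ≤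
      2 * ∑ j, v (.inl 0) * (z j).im * v (.inr j) := by
    rw [← Finset.sum_neg_distrib, Finset.sum_mul, Finset.mul_sum, Finset.mul_sum,
      ← Finset.sum_sub_distrib]
    refine Finset.sum_le_sum fun j _ => ?_
    have : 0 ≤ c / 2 * (v (.inr j) + 2 / c * ((z j).im * v (.inl 0))) ^ 2 := by positivity
    have h₃ : c / 2 * (v (.inr j) + 2 / c * ((z j).im * v (.inl 0))) ^ 2 =
        c / 2 * v (.inr j) ^ 2 + 2 * (v (.inl 0) * (z j).im * v (.inr j)) +
          2 / c * (z j).im ^ 2 * v (.inl 0) ^ 2 := by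
      field_simp
      ring
    linarith
  have h₄ : ∑ i, ∑ j, v i * (Tmat t z τ i j).im * v j = t * v (.inl 0) ^ 2 +
      2 * ∑ j, v (.inl 0) * (z j).im * v (.inr j) +
      ∑ i, ∑ j, v (.inr i) * (τ i j).im * v (.inr j) := by
    have h₅ : ∑ i, v (.inr i) * (z i).im * v (.inl 0) =
        ∑ j, v (.inl 0) * (z j).im * v (.inr j) :=
      Finset.sum_congr rfl fun j _ => by ring
    simp [Tmat, Fintype.sum_sum_type, Finset.sum_add_distrib, h₅]
    ring
  linarith

/-- The limit of `thetaConst m (Tmat t z τ)` as `t → ∞`. -/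
def boundaryThetaConst {k : ℕ} (m : Char2 (Fin 1 ⊕ Fin k)) (τ : Matrix (Fin k) (Fin k) ℂ) : ℂ :=
  if m.1 (.inl 0) = 0 then thetaConst (m.1 ∘ Sum.inr, m.2 ∘ Sum.inr) τ else 0

lemma thetaConstTerm_Tmat_of_inl_eq_zero {k : ℕ} {m : Char2 (Fin 1 ⊕ Fin k)}
    (hm : m.1 (.inl 0) = 0) (τ : Matrix (Fin k) (Fin k) ℂ) (z : Fin k → ℂ) (t : ℝ)
    (n : Fin k → ℤ) :
    thetaConstTerm m (Tmat t z τ) (Sum.elim (fun _ => 0) n) =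
      thetaConstTerm (m.1 ∘ Sum.inr, m.2 ∘ Sum.inr) τ n := by
  simp [thetaConstTerm, Tmat, Fintype.sum_sum_type, hm]

open Filter in
lemma tendsto_thetaConst_Tmat {k : ℕ} {τ : Matrix (Fin k) (Fin k) ℂ} (hτ : τ ∈ Siegel (Fin k))
    (z : Fin k → ℂ) (m : Char2 (Fin 1 ⊕ Fin k)) :
    Tendsto (fun t : ℝ => thetaConst m (Tmat t z τ)) atTop (nhds (boundaryThetaConst m τ)) := by
  obtain ⟨c, hc, K, hK⟩ := exists_le_im_Tmat hτ z
  set s : Fin 1 ⊕ Fin k → ℝ := fun i => ((m.1 i).val : ℝ) / 2 with hs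
  have hbound : ∀ (t : ℝ) (n : Fin 1 ⊕ Fin k → ℤ), ‖thetaConstTerm m (Tmat t z τ) n‖ ≤
      Real.exp (-Real.pi * ((t - K) * (n (.inl 0) + s (.inl 0)) ^ 2 +
        c * ∑ j, (n (.inr j) + s (.inr j)) ^ 2)) := fun t n => by
    rw [norm_thetaConstTerm, Real.exp_le_exp]
    exact mul_le_mul_of_nonpos_left (hK t fun i => n i + s i) (neg_nonpos.2 Real.pi_pos.le)
  have hlim : boundaryThetaConst m τ = ∑' n : Fin 1 ⊕ Fin k → ℤ,
      if (n (.inl 0) : ℝ) + s (.inl 0) = 0 then thetaConstTerm m (Tmat 0 z τ) n else 0 := by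
    by_cases hm : m.1 (.inl 0) = 0
    · rw [boundaryThetaConst, if_pos hm, thetaConst_eq_tsum,
        ← Function.Injective.tsum_eq (g := fun n : Fin k → ℤ =>
          (Sum.elim (fun _ => 0) n : Fin 1 ⊕ Fin k → ℤ))]
      · refine tsum_congr fun n => ?_
        rw [if_pos (by simp [hs, hm]), thetaConstTerm_Tmat_of_inl_eq_zero hm]
      · intro n n' h
        exact funext fun j => congrFun h (.inr j)
      · intro n hn
        have h0 : n (.inl 0) = 0 := by
          by_contra h
          simp [hs, hm, h] at hn
        refine ⟨fun j => n (.inr j), funext fun i => ?_⟩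
        rcases i with i | j
        · rw [Subsingleton.elim i 0, h0]
          rfl
        · rfl
    · rw [boundaryThetaConst, if_neg hm]
      have h1 : (m.1 (.inl 0)).val = 1 := by
        have := ZMod.val_lt (m.1 (.inl 0))
        have := (ZMod.val_ne_zero (m.1 (.inl 0))).2 hm
        omega
      have h2 : ∀ n : Fin 1 ⊕ Fin k → ℤ, (n (.inl 0) : ℝ) + s (.inl 0) ≠ 0 := fun n h => by
        have h3 : (2 * n (.inl 0) + 1 : ℝ) = 0 := by
          simp only [hs, h1, Nat.cast_one] at h
          linarith
        have h4 : 2 * n (.inl 0) + 1 = 0 := by exact_mod_cast h3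
        omega
      simp [h2]
  simp only [hlim, thetaConst_eq_tsum]
  refine tendsto_tsum_of_dominated_convergence
    (summable_exp_neg_shifted_sq (lt_min one_pos hc) s) (fun n => ?_) ?_
  · split_ifs with hn
    · refine tendsto_const_nhds.congr fun t => ?_
      have hn' : (n (.inl 0) : ℂ) + ((m.1 (.inl 0)).val : ℂ) / 2 = 0 := by
        simpa only [hs, Complex.ofReal_add, Complex.ofReal_div, Complex.ofReal_intCast,
          Complex.ofReal_natCast, Complex.ofReal_ofNat, Complex.ofReal_zero] using
            congrArg Complex.ofReal hn
      simp only [thetaConstTerm, Tmat, Fintype.sum_sum_type, Finset.univ_unique,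
        Fin.default_eq_zero, Finset.sum_singleton, hn', zero_mul, mul_zero,
        Matrix.fromBlocks_apply₂₂, Finset.sum_const_zero, zero_add]
    · refine squeeze_zero_norm (hbound · n) (Real.tendsto_exp_atBot.comp ?_)
      refine Tendsto.const_mul_atTop_of_neg (neg_lt_zero.2 Real.pi_pos) ?_
      refine tendsto_atTop_add_const_right _ _ (Tendsto.atTop_mul_const (by positivity) ?_)
      exact tendsto_atTop_add_const_right _ _ tendsto_id
  · filter_upwards [eventually_ge_atTop (K + 1)] with t ht n
    refine (hbound t n).trans (Real.exp_le_exp.2 ?_)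
    refine mul_le_mul_of_nonpos_left ?_ (neg_nonpos.2 Real.pi_pos.le)
    rw [Fintype.sum_sum_type, mul_add]
    refine add_le_add ?_ ?_
    · simp only [Finset.univ_unique, Fin.default_eq_zero, Finset.sum_singleton]
      exact mul_le_mul_of_nonneg_right ((min_le_left _ _).trans (by linarith)) (sq_nonneg _)
    · exact mul_le_mul_of_nonneg_right (min_le_right _ _)
        (Finset.sum_nonneg fun _ _ => sq_nonneg _)

lemma sum_fin_one_sum_arrow {k : ℕ} {α M : Type*} [Fintype α] [AddCommMonoid M]
    (f : α → (Fin k → α) → M) :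
    ∑ v : Fin 1 ⊕ Fin k → α, f (v (.inl 0)) (v ∘ Sum.inr) = ∑ a, ∑ w, f a w := by
  classical
  rw [← Fintype.sum_prod_type']
  exact Fintype.sum_equiv ((Equiv.sumArrowEquivProdArrow (Fin 1) (Fin k) α).trans
    ((Equiv.funUnique (Fin 1) α).prodCongr (Equiv.refl _))) _ _ fun v => rfl

lemma sum_boundaryThetaConst_pow {k : ℕ} (τ : Matrix (Fin k) (Fin k) ℂ) {p : ℕ} (hp : p ≠ 0) :
    ∑ m, boundaryThetaConst m τ ^ p = 2 * ∑ m, thetaConst m τ ^ p := by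
  simp only [Fintype.sum_prod_type, boundaryThetaConst]
  rw [sum_fin_one_sum_arrow fun a w => ∑ d : Fin 1 ⊕ Fin k → ZMod 2,
    (if a = 0 then thetaConst (w, d ∘ Sum.inr) τ else 0) ^ p]
  have h : ∀ (a : ZMod 2) (w : Fin k → ZMod 2), ∑ d : Fin 1 ⊕ Fin k → ZMod 2,
      (if a = 0 then thetaConst (w, d ∘ Sum.inr) τ else 0) ^ p =
        if a = 0 then 2 * ∑ d, thetaConst (w, d) τ ^ p else 0 := fun a w => by
    rw [sum_fin_one_sum_arrow fun _ d => (if a = 0 then thetaConst (w, d) τ else 0) ^ p]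
    split_ifs <;> simp [hp]
  simp_rw [h]
  rw [Finset.sum_eq_single 0 (fun a _ ha => by simp [ha]) (by simp)]
  simp [Finset.mul_sum]

open Filter in
/-- Near the boundary, the constant term of the expansion of `F_g` is `4·F_{g−1}`. -/
theorem Fmod_boundary_constant_term (g : ℕ) (hg : 2 ≤ g)
    (τ : Matrix (Fin (g - 1)) (Fin (g - 1)) ℂ) (hτ : τ ∈ Siegel (Fin (g - 1)))
    (z : Fin (g - 1) → ℂ) :
    Tendsto (fun t : ℝ => Fmod (Fin 1 ⊕ Fin (g - 1)) (Tmat t z τ)) atTop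
      (nhds (4 * Fmod (Fin (g - 1)) τ)) := by
  have h : ∀ p : ℕ, p ≠ 0 → Tendsto
      (fun t : ℝ => ∑ m : Char2 (Fin 1 ⊕ Fin (g - 1)), thetaConst m (Tmat t z τ) ^ p) atTop
      (nhds (2 * ∑ m : Char2 (Fin (g - 1)), thetaConst m τ ^ p)) := fun p hp => by
    rw [← sum_boundaryThetaConst_pow τ hp]
    exact tendsto_finsetSum _ fun m _ => (tendsto_thetaConst_Tmat hτ z m).pow p
  have h₁ := ((h 16 (by norm_num)).const_mul (2 ^ Fintype.card (Fin 1 ⊕ Fin (g - 1)))).sub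
    ((h 8 (by norm_num)).pow 2)
  have h₂ : 4 * Fmod (Fin (g - 1)) τ = 2 ^ Fintype.card (Fin 1 ⊕ Fin (g - 1)) *
      (2 * ∑ m : Char2 (Fin (g - 1)), thetaConst m τ ^ 16) -
        (2 * ∑ m : Char2 (Fin (g - 1)), thetaConst m τ ^ 8) ^ 2 := by
    simp only [Fmod, Fintype.card_sum, Fintype.card_fin, pow_add]
    ring
  rw [h₂]
  exact h₁
end
end
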